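/- For every finite simple graph G, χ_rlid(G\R) − t(G) ≤ χ_rlid(G). Equivalently, χ_rlid(G\R) ≤ χ_rlid(G) + t(G): if G admits an rlid-coloring with n colors, then its maximal twin-free induced subgraph G\R admits an rlid-coloring with at most n + t(G) colors. -/

import Mathlib

open SimpleGraph

variable {V : Type*}

/-- The closed neighborhood `N[u]` of a vertex `u`. -/
def closedNbhd (G : SimpleGraph V) (u : V) : Set V := insert u (G.neighborSet u)

/-- Two vertices are twins if they have the same closed neighborhood. -/
def Twins (G : SimpleGraph V) (u v : V) : Prop := closedNbhd G u = closedNbhd G v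

/-- `c` is a relaxed locally identifying (rlid-) coloring of `G`: every pair of
adjacent non-twin vertices gets distinct color sets on their closed neighborhoods. -/
def IsRlidColoring {α : Type*} (G : SimpleGraph V) (c : V → α) : Prop :=
  ∀ u v : V, G.Adj u v → ¬ Twins G u v → c '' closedNbhd G u ≠ c '' closedNbhd G v

/-- `χ_rlid(G)`: the minimum number of colors in an rlid-coloring of `G`. -/
noncomputable def chiRlid (G : SimpleGraph V) : ℕ :=
  sInf {n | ∃ c : V → Fin n, IsRlidColoring G c}

/-- `s` is a set of representatives of the twin-equivalence classes of `G`: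
it contains exactly one vertex from each class. The induced subgraph of `G` on
such a set is the maximal twin-free induced subgraph `G\R` (the quotient of `G`
by the twin relation `R`), well-defined up to isomorphism. -/
def IsRepSet (G : SimpleGraph V) (s : Finset V) : Prop :=
  ∀ v : V, ∃! w, w ∈ s ∧ Twins G v w

open Classical in
/-- The twin-equivalence class of a vertex, as a `Finset`. -/
noncomputable def twinClass (G : SimpleGraph V) [Fintype V] (v : V) : Finset V :=
  Finset.univ.filter (Twins G v)

open Classical in
/-- `t(G)`: the number of twin-equivalence classes with at least two vertices. -/
noncomputable def numBigTwinClasses (G : SimpleGraph V) [Fintype V] : ℕ :=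
  ((Finset.univ.image (twinClass G)).filter (fun Q => 2 ≤ Q.card)).card

theorem Twins.mem_closedNbhd_iff {G : SimpleGraph V} {x y : V} (h : Twins G x y) (u : V) :
    x ∈ closedNbhd G u ↔ y ∈ closedNbhd G u := by
  have mem_comm (a b : V) : a ∈ closedNbhd G b ↔ b ∈ closedNbhd G a := by
    simp only [closedNbhd, Set.mem_insert_iff, SimpleGraph.mem_neighborSet, G.adj_comm, eq_comm]
  rw [mem_comm x, mem_comm y, h]

theorem closedNbhd_induce (G : SimpleGraph V) (s : Set V) (u : s) :
    closedNbhd (G.induce s) u = Subtype.val ⁻¹' closedNbhd G u := by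
  ext x
  simp [closedNbhd, Subtype.ext_iff]

theorem IsRlidColoring.comp_injective {α β : Type*} {G : SimpleGraph V} {c : V → α}
    (hc : IsRlidColoring G c) {f : α → β} (hf : Function.Injective f) :
    IsRlidColoring G (f ∘ c) := by
  intro u v huv ht h
  rw [Set.image_comp, Set.image_comp] at h
  exact hc u v huv ht (hf.image_injective h)

theorem isRlidColoring_id (G : SimpleGraph V) : IsRlidColoring G (id : V → V) := by
  intro u v _ ht h
  exact ht (by simpa [Twins] using h)

theorem IsRlidColoring.chiRlid_le {α : Type*} [Fintype α] {G : SimpleGraph V} {c : V → α}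
    (hc : IsRlidColoring G c) : chiRlid G ≤ Fintype.card α :=
  Nat.sInf_le ⟨_, hc.comp_injective (Fintype.equivFin α).injective⟩

theorem exists_isRlidColoring_chiRlid [Fintype V] (G : SimpleGraph V) :
    ∃ c : V → Fin (chiRlid G), IsRlidColoring G c :=
  Nat.sInf_mem (s := {n | ∃ c : V → Fin n, IsRlidColoring G c})
    ⟨_, _, (isRlidColoring_id G).comp_injective (Fintype.equivFin V).injective⟩

open Classical in
/-- The twin classes with at least two vertices. -/
noncomputable def bigTwinClasses (G : SimpleGraph V) [Fintype V] : Finset (Finset V) :=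
  (Finset.univ.image (twinClass G)).filter (fun Q => 2 ≤ Q.card)

theorem mem_twinClass [Fintype V] {G : SimpleGraph V} {x y : V} :
    y ∈ twinClass G x ↔ Twins G x y := by
  simp [twinClass]

theorem twinClass_mem_bigTwinClasses [Fintype V] {G : SimpleGraph V} {x : V} :
    twinClass G x ∈ bigTwinClasses G ↔ 2 ≤ (twinClass G x).card := by
  simp [bigTwinClasses]

theorem Twins.eq_of_notMem_bigTwinClasses [Fintype V] {G : SimpleGraph V} {x y : V}
    (h : Twins G x y) (hx : twinClass G x ∉ bigTwinClasses G) : x = y := by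
  rw [twinClass_mem_bigTwinClasses] at hx
  exact Finset.card_le_one.1 (by lia) x (mem_twinClass.2 rfl) y (mem_twinClass.2 h)

theorem Twins.twinClass_eq [Fintype V] {G : SimpleGraph V} {x y : V} (h : Twins G x y) :
    twinClass G x = twinClass G y := by
  ext z
  simp only [mem_twinClass, Twins, show closedNbhd G x = closedNbhd G y from h]

open Classical in
/-- Recolor every big twin class with a fresh color of its own. -/
noncomputable def recolorBigTwinClasses {α : Type*} [Fintype V] (G : SimpleGraph V) (c : V → α)
    (x : V) : α ⊕ bigTwinClasses G :=
  if h : twinClass G x ∈ bigTwinClasses G then .inr ⟨twinClass G x, h⟩ else .inl (c x)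

/-- A color-set inclusion for the recoloring of the representatives lifts to the whole graph. -/
theorem image_closedNbhd_subset_of_recolor {α : Type*} [Fintype V] {G : SimpleGraph V}
    {s : Finset V} (hs : IsRepSet G s) (c : V → α) (u v : (s : Set V))
    (h : (fun x : (s : Set V) => recolorBigTwinClasses G c x) ''
        closedNbhd (G.induce (s : Set V)) u ⊆
      (fun x : (s : Set V) => recolorBigTwinClasses G c x) ''
        closedNbhd (G.induce (s : Set V)) v) :
    c '' closedNbhd G u ⊆ c '' closedNbhd G v := by
  rintro _ ⟨x, hx, rfl⟩
  obtain ⟨r, ⟨hrs, hxr⟩, -⟩ := hs x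
  rw [hxr.mem_closedNbhd_iff] at hx
  simp only [closedNbhd_induce] at h
  obtain ⟨⟨y, hys⟩, hy, hyr⟩ := h ⟨⟨r, hrs⟩, hx, rfl⟩
  simp only [Set.mem_preimage] at hy
  by_cases hbig : twinClass G r ∈ bigTwinClasses G
  · by_cases hbig_y : twinClass G y ∈ bigTwinClasses G
    · simp only [recolorBigTwinClasses, hbig, hbig_y, dif_pos, Sum.inr.injEq,
        Subtype.mk.injEq] at hyr
      have hry : Twins G r y := mem_twinClass.1 (hyr ▸ mem_twinClass.2 rfl)
      exact ⟨x, (hxr.mem_closedNbhd_iff _).2 ((hry.mem_closedNbhd_iff _).2 hy), rfl⟩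
    · simp [recolorBigTwinClasses, hbig, hbig_y] at hyr
  · by_cases hbig_y : twinClass G y ∈ bigTwinClasses G
    · simp [recolorBigTwinClasses, hbig, hbig_y] at hyr
    · have hxr_eq : x = r := hxr.eq_of_notMem_bigTwinClasses (hxr.twinClass_eq ▸ hbig)
      simp only [recolorBigTwinClasses, hbig, hbig_y, dif_neg, not_false_eq_true,
        Sum.inl.injEq] at hyr
      exact ⟨y, hy, by rw [hyr, hxr_eq]⟩

theorem IsRlidColoring.recolor_induce {α : Type*} [Fintype V] {G : SimpleGraph V}
    {s : Finset V} (hs : IsRepSet G s) {c : V → α} (hc : IsRlidColoring G c) :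
    IsRlidColoring (G.induce (s : Set V)) (fun x => recolorBigTwinClasses G c x) := by
  intro u v huv ht h
  refine hc u v huv (fun htwin => ht ?_)
    ((image_closedNbhd_subset_of_recolor hs c u v h.subset).antisymm
      (image_closedNbhd_subset_of_recolor hs c v u h.superset))
  rw [Twins, closedNbhd_induce, closedNbhd_induce, htwin]

/-- For every finite simple graph `G`, `χ_rlid(G\R) ≤ χ_rlid(G) + t(G)`,
i.e. `χ_rlid(G\R) - t(G) ≤ χ_rlid(G)`. -/
theorem chiRlid_quotient_le_chiRlid_add [Fintype V] (G : SimpleGraph V)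
    (s : Finset V) (hs : IsRepSet G s) :
    chiRlid (G.induce (↑s : Set V)) ≤ chiRlid G + numBigTwinClasses G := by
  obtain ⟨c, hc⟩ := exists_isRlidColoring_chiRlid G
  have h := (hc.recolor_induce hs).chiRlid_le
  rw [Fintype.card_sum, Fintype.card_fin, Fintype.card_coe] at h
  exact h
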